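/- arXiv:1202.1635 — 8 statements merged into one kernel-verified Lean document; each statement's English description precedes it below -/
import Mathlib

section
/- Let φ be a flow on a topological space X which is T1. Then for every x ∈ X, the point x is non-periodic (i.e. t·x ≠ x for all t ≠ 0) if and only if the open set X \ {x} is an r-exterior subset of X. -/
open Set

/-- An open subset `N` is r-exterior for the flow `φ` if for every point `x` there is
`t₀ ∈ ℝ` such that `φ t x ∈ N` for all `t ≥ t₀`. -/
def RExterior {X : Type*} [TopologicalSpace X] (φ : ℝ → X → X) (N : Set X) : Prop :=
  IsOpen N ∧ ∀ x : X, ∃ t₀ : ℝ, ∀ t : ℝ, t₀ ≤ t → φ t x ∈ N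

/-- A period of a point under an additive action of `ℝ` has all its natural multiples as periods. -/
theorem flow_nat_mul_eq_self {X : Type*} {φ : ℝ → X → X} (h0 : ∀ x, φ 0 x = x)
    (hadd : ∀ t s x, φ t (φ s x) = φ (t + s) x) {x : X} {t : ℝ} (ht : φ t x = x) (n : ℕ) :
    φ (n * t) x = x := by
  induction n with
  | zero => simpa using h0 x
  | succ n ih =>
    have h := hadd (n * t) t x
    rw [ht, ih] at h
    rw [Nat.cast_succ, add_one_mul, ← h]

/-- If `t` is a period of a point under an additive action of `ℝ`, then so is `|t|`. -/
theorem flow_abs_eq_self {X : Type*} {φ : ℝ → X → X} (h0 : ∀ x, φ 0 x = x)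
    (hadd : ∀ t s x, φ t (φ s x) = φ (t + s) x) {x : X} {t : ℝ} (ht : φ t x = x) :
    φ |t| x = x := by
  rcases abs_choice t with h | h <;> rw [h]
  · exact ht
  · have h := hadd (-t) t x
    rwa [ht, neg_add_cancel, h0] at h

/-- For a flow on a `T1` space, a point `x` is non-periodic iff `X \ {x}` is r-exterior. -/
theorem nonperiodic_iff_compl_singleton_rExterior {X : Type*} [TopologicalSpace X] [T1Space X]
    (φ : ℝ → X → X)
    (hcont : Continuous fun p : ℝ × X => φ p.1 p.2)
    (h0 : ∀ x, φ 0 x = x)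
    (hadd : ∀ t s x, φ t (φ s x) = φ (t + s) x)
    (x : X) :
    (∀ t : ℝ, t ≠ 0 → φ t x ≠ x) ↔ RExterior φ ({x}ᶜ : Set X) := by
  constructor
  · refine fun hx => ⟨isOpen_compl_singleton, fun y => ?_⟩
    by_cases hy : ∃ s, φ s y = x
    · obtain ⟨s, rfl⟩ := hy
      refine ⟨s + 1, fun t ht heq => hx (t - s) (by linarith) ?_⟩
      rw [hadd, sub_add_cancel]
      exact heq
    · exact ⟨0, fun t _ heq => hy ⟨t, heq⟩⟩
  · rintro ⟨-, hN⟩ t ht htx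
    obtain ⟨t₀, ht₀⟩ := hN x
    obtain ⟨n, hn⟩ := Archimedean.arch t₀ (abs_pos.mpr ht)
    rw [nsmul_eq_mul] at hn
    exact ht₀ _ hn (flow_nat_mul_eq_self h0 hadd (flow_abs_eq_self h0 hadd htx) n)
end

section
/- Let φ be a flow on a topological space X which is T1. Then the set of periodic points equals the limit space: P(X) = L^r(X). -/
open Set

/-- The limit space `L^r(X)`: the intersection of all r-exterior open subsets. -/
def limitR {X : Type*} [TopologicalSpace X] (φ : ℝ → X → X) : Set X :=
  ⋂₀ {E : Set X | RExterior φ E}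

/-- The set of periodic points of the flow. -/
def periodicPts {X : Type*} [TopologicalSpace X] (φ : ℝ → X → X) : Set X :=
  {x : X | ∃ t : ℝ, t ≠ 0 ∧ φ t x = x}

/-- A point fixed by the time-`t` map is fixed by the time-`n * t` map for every `n : ℕ`. -/
theorem flow_natCast_mul_eq_self {X : Type*} {φ : ℝ → X → X} (h0 : ∀ x, φ 0 x = x)
    (hadd : ∀ t s x, φ t (φ s x) = φ (t + s) x) {t : ℝ} {x : X} (hx : φ t x = x) (n : ℕ) :
    φ (n * t) x = x := by
  induction n with
  | zero => simp [h0]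
  | succ n ih =>
    rw [Nat.cast_succ, add_one_mul, ← hadd, hx, ih]

/-- A periodic point has a positive period. -/
theorem exists_pos_period {X : Type*} {φ : ℝ → X → X} (h0 : ∀ x, φ 0 x = x)
    (hadd : ∀ t s x, φ t (φ s x) = φ (t + s) x) {t : ℝ} {x : X} (ht : t ≠ 0) (hx : φ t x = x) :
    ∃ s : ℝ, 0 < s ∧ φ s x = x := by
  rcases ht.lt_or_gt with h | h
  · refine ⟨-t, neg_pos.2 h, ?_⟩
    conv_lhs => rw [← hx]
    rw [hadd, neg_add_cancel, h0]
  · exact ⟨t, h, hx⟩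

/-- For a flow on a `T1` space, the complement of a non-periodic point is r-exterior. -/
theorem rExterior_compl_singleton {X : Type*} [TopologicalSpace X] [T1Space X] {φ : ℝ → X → X}
    (hadd : ∀ t s x, φ t (φ s x) = φ (t + s) x) {x : X} (hx : x ∉ periodicPts φ) :
    RExterior φ {x}ᶜ := by
  refine ⟨isOpen_compl_singleton, fun y => ?_⟩
  by_cases hy : ∃ s, φ s y = x
  · obtain ⟨s, hs⟩ := hy
    refine ⟨s + 1, fun t ht htx => hx ⟨t - s, by linarith, ?_⟩⟩
    conv_lhs => rw [← hs]
    rw [hadd, sub_add_cancel]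
    exact htx
  · exact ⟨0, fun t _ htx => hy ⟨t, htx⟩⟩

/-- For a flow on a `T1` space, the set of periodic points equals the limit space. -/
theorem periodic_eq_limitR {X : Type*} [TopologicalSpace X] [T1Space X] (φ : ℝ → X → X)
    (hcont : Continuous fun p : ℝ × X => φ p.1 p.2)
    (h0 : ∀ x, φ 0 x = x)
    (hadd : ∀ t s x, φ t (φ s x) = φ (t + s) x) :
    periodicPts φ = limitR φ := by
  refine Subset.antisymm ?_ fun x hx => ?_
  · rintro x ⟨t, ht, hx⟩ E ⟨-, hE⟩
    obtain ⟨s, hs, hsx⟩ := exists_pos_period h0 hadd ht hx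
    obtain ⟨t₀, ht₀⟩ := hE x
    obtain ⟨n, hn⟩ := Archimedean.arch t₀ hs
    rw [nsmul_eq_mul] at hn
    simpa only [flow_natCast_mul_eq_self h0 hadd hsx n] using ht₀ _ hn
  · by_contra h
    exact hx _ (rExterior_compl_singleton hadd h) rfl
end

section
/- For any flow φ on a topological space X, the limit space L^r(X) and the bar-limit space L̄^r(X) are invariant subsets of the flow; that is, for every s ∈ ℝ, φ_s(L^r(X)) = L^r(X) and φ_s(L̄^r(X)) = L̄^r(X). -/
open Set

/-- The bar-limit space `L̄^r(X)`: the intersection of the closures of all r-exterior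
open subsets. -/
def barLimitR {X : Type*} [TopologicalSpace X] (φ : ℝ → X → X) : Set X :=
  ⋂ E ∈ {E : Set X | RExterior φ E}, closure E

theorem RExterior.preimage {X : Type*} [TopologicalSpace X] {φ : ℝ → X → X} {E : Set X}
    (hE : RExterior φ E) {s : ℝ} (hs : Continuous (φ s))
    (hadd : ∀ t s x, φ t (φ s x) = φ (t + s) x) : RExterior φ (φ s ⁻¹' E) := by
  refine ⟨hE.1.preimage hs, fun x => ?_⟩
  obtain ⟨t₀, ht₀⟩ := hE.2 x
  refine ⟨t₀ - s, fun t ht => ?_⟩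
  rw [mem_preimage, hadd]
  exact ht₀ _ (by linarith)

theorem mapsTo_limitR {X : Type*} [TopologicalSpace X] {φ : ℝ → X → X} {s : ℝ}
    (hs : Continuous (φ s)) (hadd : ∀ t s x, φ t (φ s x) = φ (t + s) x) :
    MapsTo (φ s) (limitR φ) (limitR φ) :=
  fun _ hx E hE => hx (φ s ⁻¹' E) (RExterior.preimage hE hs hadd)

theorem mapsTo_barLimitR {X : Type*} [TopologicalSpace X] {φ : ℝ → X → X} {s : ℝ}
    (hs : Continuous (φ s)) (hadd : ∀ t s x, φ t (φ s x) = φ (t + s) x) :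
    MapsTo (φ s) (barLimitR φ) (barLimitR φ) :=
  fun _ hx => mem_iInter₂.2 fun E hE =>
    hs.closure_preimage_subset E (mem_iInter₂.1 hx _ (RExterior.preimage hE hs hadd))

/-- A set mapped into itself by every time of a flow is equal to each of its translates. -/
theorem image_flow_eq_of_mapsTo {X : Type*} {φ : ℝ → X → X} (h0 : ∀ x, φ 0 x = x)
    (hadd : ∀ t s x, φ t (φ s x) = φ (t + s) x) {A : Set X}
    (hA : ∀ s, MapsTo (φ s) A A) (s : ℝ) : φ s '' A = A :=
  (hA s).image_subset.antisymm fun x hx =>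
    ⟨φ (-s) x, hA (-s) hx, by rw [hadd, add_neg_cancel, h0]⟩

/-- The limit space and the bar-limit space of a flow are invariant subsets. -/
theorem limitR_barLimitR_invariant {X : Type*} [TopologicalSpace X] (φ : ℝ → X → X)
    (hcont : Continuous fun p : ℝ × X => φ p.1 p.2)
    (h0 : ∀ x, φ 0 x = x)
    (hadd : ∀ t s x, φ t (φ s x) = φ (t + s) x) :
    (∀ s : ℝ, (φ s) '' limitR φ = limitR φ) ∧
    (∀ s : ℝ, (φ s) '' barLimitR φ = barLimitR φ) := by
  have hs (s : ℝ) : Continuous (φ s) := hcont.comp (Continuous.prodMk_right s)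
  exact ⟨image_flow_eq_of_mapsTo h0 hadd fun s => mapsTo_limitR (hs s) hadd,
    image_flow_eq_of_mapsTo h0 hadd fun s => mapsTo_barLimitR (hs s) hadd⟩
end

section
/- For any flow φ on a topological space X, the Ω^r-limit set is contained in the bar-limit space: Ω^r(X) ⊆ L̄^r(X). -/
open Set

/-- The right limit set `ω^r(p) = ⋂_{t ≥ 0} closure {s·p : s ≥ t}`. -/
def omegaR {X : Type*} [TopologicalSpace X] (φ : ℝ → X → X) (p : X) : Set X :=
  ⋂ t ∈ Ici (0 : ℝ), closure ((fun s : ℝ => φ s p) '' Ici t)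

/-- The `Ω^r`-limit set of the flow. -/
def OmegaR {X : Type*} [TopologicalSpace X] (φ : ℝ → X → X) : Set X :=
  ⋃ p : X, omegaR φ p

/-- The `Ω^r`-limit set is contained in the bar-limit space. -/
theorem OmegaR_subset_barLimitR {X : Type*} [TopologicalSpace X] (φ : ℝ → X → X)
    (hcont : Continuous fun p : ℝ × X => φ p.1 p.2)
    (h0 : ∀ x, φ 0 x = x)
    (hadd : ∀ t s x, φ t (φ s x) = φ (t + s) x) :
    OmegaR φ ⊆ barLimitR φ := by
  refine iUnion_subset fun p x hx => mem_iInter₂.2 fun E hE => ?_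
  obtain ⟨t₀, ht₀⟩ := hE.2 p
  refine closure_mono ?_ (mem_iInter₂.1 hx (max t₀ 0) (le_max_right t₀ 0))
  rintro _ ⟨s, hs, rfl⟩
  exact ht₀ s ((le_max_left t₀ 0).trans hs)
end

section
/- Let φ be a flow on a topological space X and x ∈ X. If there exists an open neighborhood V of x such that X \ closure(V) is an r-exterior subset of X, then x ∉ closure(Ω^r(X)). -/
open Set

/-- If some open neighborhood `V` of `x` satisfies that `X \ closure V` is r-exterior,
then `x ∉ closure (Ω^r(X))`. -/
theorem not_mem_closure_OmegaR {X : Type*} [TopologicalSpace X] (φ : ℝ → X → X)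
    (hcont : Continuous fun p : ℝ × X => φ p.1 p.2)
    (h0 : ∀ x, φ 0 x = x)
    (hadd : ∀ t s x, φ t (φ s x) = φ (t + s) x)
    (x : X)
    (hV : ∃ V : Set X, IsOpen V ∧ x ∈ V ∧ RExterior φ (closure V)ᶜ) :
    x ∉ closure (OmegaR φ) := by
  obtain ⟨V, hVo, hxV, -, hext⟩ := hV
  intro hx
  obtain ⟨y, hyV, hy⟩ := mem_closure_iff.1 hx V hVo hxV
  obtain ⟨p, hp⟩ := mem_iUnion.1 hy
  obtain ⟨t₀, ht₀⟩ := hext p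
  have hcl : y ∈ closure ((fun s : ℝ => φ s p) '' Ici (max t₀ 0)) :=
    mem_iInter₂.1 hp (max t₀ 0) (le_max_right t₀ 0)
  obtain ⟨_, hzV, s, hs, rfl⟩ := mem_closure_iff.1 hcl V hVo hyV
  exact ht₀ s ((le_max_left t₀ 0).trans hs) (subset_closure hzV)
end

section
/- Let φ be a flow on a topological space X which is locally compact and regular. If x ∉ closure(Ω^r(X)), then there exists an open neighborhood V of x such that X \ closure(V) is an r-exterior subset of X. -/
open Set

/-- On a locally compact regular space, if `x ∉ closure (Ω^r(X))` then there is an open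
neighborhood `V` of `x` such that `X \ closure V` is r-exterior. -/
theorem exists_nbhd_compl_closure_rExterior {X : Type*} [TopologicalSpace X]
    [LocallyCompactSpace X] [RegularSpace X] (φ : ℝ → X → X)
    (hcont : Continuous fun p : ℝ × X => φ p.1 p.2)
    (h0 : ∀ x, φ 0 x = x)
    (hadd : ∀ t s x, φ t (φ s x) = φ (t + s) x)
    (x : X) (hx : x ∉ closure (OmegaR φ)) :
    ∃ V : Set X, IsOpen V ∧ x ∈ V ∧ RExterior φ (closure V)ᶜ := by
  obtain ⟨K, hKx, hKU, hK⟩ := local_compact_nhds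
    (isClosed_closure.isOpen_compl.mem_nhds (show x ∈ (closure (OmegaR φ))ᶜ from hx))
  have hCU : closure K ⊆ (closure (OmegaR φ))ᶜ :=
    hK.closure_subset_of_isOpen isClosed_closure.isOpen_compl hKU
  refine ⟨interior K, isOpen_interior, mem_interior_iff_mem_nhds.2 hKx,
    isClosed_closure.isOpen_compl, fun p => ?_⟩
  by_contra! h
  have hfreq : ∃ᶠ t in Filter.atTop, φ t p ∈ closure K := by
    rw [Filter.frequently_atTop]
    intro t₀
    obtain ⟨t, ht, hmem⟩ := h t₀
    exact ⟨t, ht, closure_mono interior_subset (not_not.1 hmem)⟩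
  obtain ⟨y, hyK, hy⟩ := hK.closure.exists_mapClusterPt_of_frequently hfreq
  refine hCU hyK (subset_closure (mem_iUnion.2 ⟨p, mem_iInter₂.2 fun t _ => ?_⟩))
  exact mem_closure_iff_clusterPt.2 (ClusterPt.mono hy (Filter.le_principal_iff.2
    (Filter.image_mem_map (Filter.Ici_mem_atTop t))))
end

section
/- Let φ be a flow on a topological space X which is locally compact and regular. Then the bar-limit space is contained in the closure of the Ω^r-limit set: L̄^r(X) ⊆ closure(Ω^r(X)). -/
open Set

/-- A cluster point of the forward orbit of `p` belongs to the right limit set of `p`. -/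
theorem mem_omegaR_of_mapClusterPt {X : Type*} [TopologicalSpace X] {φ : ℝ → X → X} {p a : X}
    (ha : MapClusterPt a Filter.atTop fun t : ℝ => φ t p) : a ∈ omegaR φ p := by
  refine mem_iInter₂.2 fun t _ => mem_closure_iff_clusterPt.2 (ClusterPt.mono ha ?_)
  exact Filter.le_principal_iff.2 (Filter.image_mem_map (Filter.Ici_mem_atTop t))

/-- The complement of a closed compact set disjoint from `OmegaR φ` is r-exterior. -/
theorem RExterior.compl_of_disjoint_OmegaR {X : Type*} [TopologicalSpace X] {φ : ℝ → X → X}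
    {K : Set X} (hK : IsCompact K) (hKc : IsClosed K) (hd : Disjoint K (OmegaR φ)) :
    RExterior φ Kᶜ := by
  refine ⟨hKc.isOpen_compl, fun y => Filter.eventually_atTop.1 ?_⟩
  by_contra hy
  have hf : ∃ᶠ t in Filter.atTop, φ t y ∈ K := by
    simpa [Filter.Frequently] using hy
  obtain ⟨a, haK, ha⟩ := hK.exists_mapClusterPt_of_frequently hf
  exact disjoint_left.1 hd haK (mem_iUnion.2 ⟨y, mem_omegaR_of_mapClusterPt ha⟩)

/-- On a locally compact regular space, `L̄^r(X) ⊆ closure (Ω^r(X))`. -/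
theorem barLimitR_subset_closure_OmegaR {X : Type*} [TopologicalSpace X]
    [LocallyCompactSpace X] [RegularSpace X] (φ : ℝ → X → X)
    (hcont : Continuous fun p : ℝ × X => φ p.1 p.2)
    (h0 : ∀ x, φ 0 x = x)
    (hadd : ∀ t s x, φ t (φ s x) = φ (t + s) x) :
    barLimitR φ ⊆ closure (OmegaR φ) := by
  intro x hx
  by_contra hxc
  obtain ⟨K, ⟨hKx, hK, hKc⟩, hKU⟩ := (isCompact_isClosed_basis_nhds x).mem_iff.1
    (isClosed_closure.isOpen_compl.mem_nhds hxc)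
  have hd : Disjoint K (OmegaR φ) :=
    disjoint_left.2 fun y hy hyΩ => hKU hy (subset_closure hyΩ)
  have hcl : x ∈ closure Kᶜ :=
    mem_iInter₂.1 hx _ (RExterior.compl_of_disjoint_OmegaR hK hKc hd)
  rw [closure_compl] at hcl
  exact hcl (mem_interior_iff_mem_nhds.2 hKx)
end

section
/- Let (X, ε) be an exterior space which is locally compact at infinity, i.e. for every E ∈ ε there exists E' ∈ ε such that closure(E') is compact and closure(E') ⊆ E. Then L(X) = L̄(X) and this set is compact. -/
open Set

/-- An externology on a topological space `X`: a nonempty collection of open subsets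
closed under finite intersections and under open enlargement. -/
def IsExternology {X : Type*} [TopologicalSpace X] (ε : Set (Set X)) : Prop :=
  ε.Nonempty ∧ (∀ E ∈ ε, IsOpen E) ∧ (∀ E ∈ ε, ∀ F ∈ ε, E ∩ F ∈ ε) ∧
    (∀ E ∈ ε, ∀ U : Set X, IsOpen U → E ⊆ U → U ∈ ε)

/-- If the exterior space `(X, ε)` is locally compact at infinity, then
`L(X) = L̄(X)` and this set is compact. -/
theorem limit_eq_barLimit_isCompact_of_locallyCompactAtInfinity {X : Type*}
    [TopologicalSpace X] (ε : Set (Set X)) (hε : IsExternology ε)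
    (hlc : ∀ E ∈ ε, ∃ E' ∈ ε, IsCompact (closure E') ∧ closure E' ⊆ E) :
    ⋂₀ ε = ⋂ E ∈ ε, closure E ∧ IsCompact (⋂₀ ε) := by
  have heq : ⋂₀ ε = ⋂ E ∈ ε, closure E := by
    refine Subset.antisymm ?_ ?_
    · exact subset_iInter₂ fun E hE => (sInter_subset_of_mem hE).trans subset_closure
    · refine subset_sInter fun E hE => ?_
      obtain ⟨E', hE', -, hsub⟩ := hlc E hE
      exact (biInter_subset_of_mem hE').trans hsub
  refine ⟨heq, ?_⟩
  obtain ⟨E, hE⟩ := hε.1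
  obtain ⟨E', hE', hcompact, -⟩ := hlc E hE
  rw [heq]
  exact hcompact.of_isClosed_subset (isClosed_biInter fun _ _ => isClosed_closure)
    (biInter_subset_of_mem hE')
end
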